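/- Let V be a real inner product space, n ≥ 1, let y = (y_1, …, y_n) ∈ V^n satisfy Σ_{i=1}^n y_i = 0 and Σ_{i=1}^n ‖y_i‖² = 1, and let t ∈ [0,1]. With F_t = (1−t)·P(y) + t·Id_V, there exists an index i ∈ {1, …, n} such that ‖F_t(y_i)‖ ≥ 1/n^{3/2} (that is, ‖F_t(y_i)‖ ≥ 2ρ, where ρ = 1/(2·n^{3/2})). -/

import Mathlib

open scoped RealInnerProductSpace

/-- The linear operator `P(y)` on `V` associated to a tuple `y = (y_1, …, y_n)` of
vectors of `V`, given by `P(y)(v) = Σ_j ⟪v, y_j⟫ • y_j`. -/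
noncomputable def Pmap {V : Type*} [NormedAddCommGroup V] [InnerProductSpace ℝ V]
    {n : ℕ} (y : Fin n → V) : V →ₗ[ℝ] V where
  toFun v := ∑ j, ⟪v, y j⟫ • y j
  map_add' u v := by
    simp [inner_add_left, add_smul, Finset.sum_add_distrib]
  map_smul' c v := by
    simp [real_inner_smul_left, mul_smul, Finset.smul_sum]

/-- If `y ∈ S(V,n)` (i.e. `Σ y_i = 0` and `Σ ‖y_i‖² = 1`) and `t ∈ [0,1]`, then with
`F_t = (1−t)·P(y) + t·Id` there is an index `i` with `‖F_t(y_i)‖ ≥ 1/n^(3/2) = 2ρ`. -/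
theorem exists_norm_Ft_ge {V : Type*} [NormedAddCommGroup V] [InnerProductSpace ℝ V]
    (n : ℕ) (hn : 1 ≤ n) (y : Fin n → V)
    (hsum : ∑ i, y i = 0) (hnorm : ∑ i, ‖y i‖ ^ 2 = 1)
    (t : ℝ) (h0 : 0 ≤ t) (h1 : t ≤ 1) :
    ∃ i : Fin n, 1 / (n : ℝ) ^ ((3 : ℝ) / 2) ≤
      ‖((1 - t) • Pmap y + t • (LinearMap.id : V →ₗ[ℝ] V)) (y i)‖ := by
  set F : V →ₗ[ℝ] V := (1 - t) • Pmap y + t • LinearMap.id with hF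
  have hn0 : (0 : ℝ) < n := by exact_mod_cast hn
  by_contra! hlt
  have hpow : (1 / (n : ℝ) ^ ((3 : ℝ) / 2)) ^ 2 = 1 / (n : ℝ) ^ 3 := by
    rw [div_pow, one_pow, ← Real.rpow_natCast, ← Real.rpow_mul hn0.le, ← Real.rpow_natCast]
    norm_num
  have hsq : ∑ i, ‖F (y i)‖ ^ 2 < 1 / (n : ℝ) ^ 2 := by
    calc ∑ i, ‖F (y i)‖ ^ 2 < ∑ _i : Fin n, 1 / (n : ℝ) ^ 3 := by
          refine Finset.sum_lt_sum_of_nonempty ⟨⟨0, hn⟩, Finset.mem_univ _⟩ fun i _ => ?_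
          rw [← hpow]
          exact pow_lt_pow_left₀ (hlt i) (norm_nonneg _) two_ne_zero
      _ = 1 / (n : ℝ) ^ 2 := by
          simp only [Finset.sum_const, Finset.card_univ, Fintype.card_fin, nsmul_eq_mul]
          field_simp
  have hdiag : 1 / (n : ℝ) ≤ ∑ i, (‖y i‖ ^ 2) ^ 2 := by
    have h := sq_sum_le_card_mul_sum_sq (s := Finset.univ) (f := fun i => ‖y i‖ ^ 2)
    rw [hnorm, Finset.card_univ, Fintype.card_fin] at h
    rw [div_le_iff₀' hn0]
    linarith
  have hn1 : 1 / (n : ℝ) ≤ 1 := by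
    rw [div_le_one hn0]
    exact_mod_cast hn
  have hinner (i : Fin n) :
      (1 - t) * (‖y i‖ ^ 2) ^ 2 + t * ‖y i‖ ^ 2 ≤ ‖F (y i)‖ * ‖y i‖ := by
    refine le_trans ?_ (real_inner_le_norm (F (y i)) (y i))
    have hP : (‖y i‖ ^ 2) ^ 2 ≤ ⟪Pmap y (y i), y i⟫ := by
      have h : ⟪Pmap y (y i), y i⟫ = ∑ j, ⟪y i, y j⟫ ^ 2 := by
        simp only [Pmap, LinearMap.coe_mk, AddHom.coe_mk, sum_inner, real_inner_smul_left]
        exact Finset.sum_congr rfl fun j _ => by rw [real_inner_comm (y i) (y j), sq]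
      rw [h, ← real_inner_self_eq_norm_sq]
      exact Finset.single_le_sum (f := fun j => ⟪y i, y j⟫ ^ 2)
        (fun j _ => sq_nonneg _) (Finset.mem_univ i)
    have hexp : ⟪F (y i), y i⟫ = (1 - t) * ⟪Pmap y (y i), y i⟫ + t * ‖y i‖ ^ 2 := by
      simp [hF, inner_add_left, real_inner_smul_left]
    rw [hexp]
    gcongr
  have hlow : 1 / (n : ℝ) ≤ ∑ i, ‖F (y i)‖ * ‖y i‖ := by
    refine le_trans ?_ (Finset.sum_le_sum fun i _ => hinner i)
    rw [Finset.sum_add_distrib, ← Finset.mul_sum, ← Finset.mul_sum, hnorm]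
    nlinarith
  have hcs := Finset.sum_mul_sq_le_sq_mul_sq Finset.univ (fun i => ‖F (y i)‖) (fun i => ‖y i‖)
  rw [hnorm, mul_one] at hcs
  have hlow' := pow_le_pow_left₀ (by positivity) hlow 2
  rw [div_pow, one_pow] at hlow'
  linarith
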